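/- arXiv:cs/0412108 — 2 statements merged into one kernel-verified Lean document; each statement's English description precedes it below -/
import Mathlib

section
/- For every probability distribution of X with E[X^2] < ∞, the function snr ↦ I(snr) is differentiable on (0, ∞) and its derivative satisfies d/dsnr I(snr) = (1/2) · mmse(snr); that is, the derivative of the input–output mutual information of the scalar Gaussian channel with respect to the signal-to-noise ratio equals half the minimum mean-square error. -/
open MeasureTheory ProbabilityTheory Real Filter
open scoped ENNReal NNReal Topology

noncomputable section

open scoped Classical in
/-- Kullback–Leibler divergence `D(μ ‖ ν)` in nats, with values in `[0, ∞]`. -/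
def klDiv {α : Type*} [MeasurableSpace α] (μ ν : Measure α) : ℝ≥0∞ :=
  if μ ≪ ν ∧ Integrable (llr μ ν) μ then ENNReal.ofReal (∫ x, llr μ ν x ∂μ) else ⊤

/-- Mutual information `I(A; B)` in nats: the KL divergence of the joint law of `(A, B)`
from the product of its marginals. -/
def mutualInfo {Ω α β : Type*} [MeasurableSpace Ω] [MeasurableSpace α] [MeasurableSpace β]
    (μ : Measure Ω) (A : Ω → α) (B : Ω → β) : ℝ≥0∞ :=
  klDiv (μ.map fun ω => (A ω, B ω)) ((μ.map A).prod (μ.map B))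

/-- Output `Y = √snr · X + N` of the scalar Gaussian channel at signal-to-noise ratio `snr`. -/
def chOut {Ω : Type*} (X N : Ω → ℝ) (snr : ℝ) : Ω → ℝ := fun ω => Real.sqrt snr * X ω + N ω

/-- Minimum mean-square error `E[(X - E[X | Y])²]` of estimating `X` given `Y`. -/
def mmse {Ω : Type*} [MeasurableSpace Ω] (μ : Measure Ω) (X Y : Ω → ℝ) : ℝ :=
  ∫ ω, (X ω - (μ[X | MeasurableSpace.comap Y inferInstance]) ω) ^ 2 ∂μ

set_option linter.unusedSectionVars false

/-- Standard Gaussian density. -/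
def gk (z : ℝ) : ℝ := (√(2 * π))⁻¹ * rexp (-z ^ 2 / 2)

lemma gk_eq (z : ℝ) : gaussianPDFReal 0 1 z = gk z := by
  simp [gaussianPDFReal, gk]

lemma gc_pos : 0 < (√(2 * π))⁻¹ := by positivity

lemma gc_le_one : (√(2 * π))⁻¹ ≤ 1 := by
  apply inv_le_one_of_one_le₀
  rw [Real.one_le_sqrt]
  nlinarith [Real.pi_gt_three]

lemma gk_pos (z : ℝ) : 0 < gk z := mul_pos gc_pos (exp_pos _)

lemma gk_le_one (z : ℝ) : gk z ≤ 1 := by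
  unfold gk
  have h1 : rexp (-z ^ 2 / 2) ≤ 1 := by
    rw [Real.exp_le_one_iff]; nlinarith [sq_nonneg z]
  exact mul_le_one₀ gc_le_one (exp_pos _).le h1

lemma gk_abs_mul_le (z : ℝ) : |z| * gk z ≤ 1 := by
  unfold gk
  have h2 : |z| * rexp (-z ^ 2 / 2) ≤ 1 := by
    have h3 : |z| ≤ rexp (z ^ 2 / 2) := by
      have := Real.add_one_le_exp (z ^ 2 / 2)
      nlinarith [sq_nonneg (|z| - 1), sq_abs z]
    calc |z| * rexp (-z ^ 2 / 2) ≤ rexp (z ^ 2 / 2) * rexp (-z ^ 2 / 2) := by gcongr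
      _ = 1 := by rw [← Real.exp_add]; simp [neg_div]
  have h0 : 0 ≤ |z| * rexp (-z ^ 2 / 2) := by positivity
  nlinarith [gc_le_one, gc_pos]

lemma gk_anti {a b : ℝ} (h : |a| ≤ |b|) : gk b ≤ gk a := by
  unfold gk
  have := sq_le_sq.2 h
  have := gc_pos
  gcongr

lemma log_gk (z : ℝ) : Real.log (gk z) = Real.log (√(2 * π))⁻¹ - z ^ 2 / 2 := by
  unfold gk
  rw [Real.log_mul gc_pos.ne' (exp_pos _).ne', Real.log_exp]; ring

lemma gk_cont : Continuous gk := by unfold gk; fun_prop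

lemma gk_meas : Measurable gk := gk_cont.measurable

lemma gk_hasDerivAt (z : ℝ) : HasDerivAt gk (-z * gk z) z := by
  unfold gk
  have h := (((hasDerivAt_id z).pow 2).neg.div_const 2).exp.const_mul (√(2 * π))⁻¹
  refine h.congr_deriv ?_
  simp
  ring

/-- Output density. -/
def gG (P : Measure ℝ) (t y : ℝ) : ℝ := ∫ x, gk (y - t * x) ∂P

/-- Posterior expectation of `f` given output `y`. -/
def gE (P : Measure ℝ) (t : ℝ) (f : ℝ → ℝ) (y : ℝ) : ℝ := (∫ x, f x * gk (y - t * x) ∂P) / gG P t y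

section an
variable {P : Measure ℝ} [IsProbabilityMeasure P]

lemma int_mul_gk {f : ℝ → ℝ} (hf : Integrable f P) (t y : ℝ) :
    Integrable (fun x => f x * gk (y - t * x)) P := by
  refine hf.mono (hf.1.mul (gk_meas.comp (by fun_prop)).aestronglyMeasurable) (ae_of_all _ fun x => ?_)
  rw [norm_mul, Real.norm_of_nonneg (gk_pos _).le]
  exact mul_le_of_le_one_right (norm_nonneg _) (gk_le_one _)

lemma int_gk (t y : ℝ) : Integrable (fun x => gk (y - t * x)) P := by
  simpa using int_mul_gk (integrable_const (1 : ℝ)) t y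

lemma int_id (h2 : Integrable (fun x : ℝ => x ^ 2) P) : Integrable (fun x : ℝ => x) P := by
  refine ((integrable_const (1 : ℝ)).add h2).mono (by fun_prop) (ae_of_all _ fun x => ?_)
  simp only [Pi.add_apply, Real.norm_eq_abs]
  rw [abs_of_nonneg (by positivity : 0 ≤ 1 + x ^ 2)]
  nlinarith [sq_nonneg (|x| - 1), sq_abs x, abs_nonneg x]

lemma gG_le_one (t y : ℝ) : gG P t y ≤ 1 := by
  have := integral_mono (int_gk (P := P) t y) (integrable_const 1) (fun x => gk_le_one (y - t * x))
  simpa [gG] using this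

/-- truncation level -/
def gM (P : Measure ℝ) : ℝ := √(2 * (∫ x, x ^ 2 ∂P + 1))

lemma m2_nonneg : 0 ≤ ∫ x : ℝ, x ^ 2 ∂P := integral_nonneg fun _ => sq_nonneg _

lemma gM_sq : gM P ^ 2 = 2 * (∫ x, x ^ 2 ∂P + 1) := by
  have := m2_nonneg (P := P)
  unfold gM; rw [Real.sq_sqrt]; positivity

lemma gM_nonneg : 0 ≤ gM P := Real.sqrt_nonneg _

lemma gG_lower (h2 : Integrable (fun x : ℝ => x ^ 2) P) {t : ℝ} (ht : 0 ≤ t) (y : ℝ) :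
    gk (|y| + t * gM P) ≤ 2 * gG P t y := by
  set R := |y| + t * gM P with hR
  have hm := m2_nonneg (P := P)
  have hM := gM_sq (P := P)
  have hM0 := gM_nonneg (P := P)
  have hM2 : 0 < gM P ^ 2 := by rw [hM]; positivity
  have hpt : ∀ x : ℝ, gk R * (1 - x ^ 2 / gM P ^ 2) ≤ gk (y - t * x) := by
    intro x
    by_cases hx : |x| ≤ gM P
    · have h1 : gk R ≤ gk (y - t * x) := by
        apply gk_anti
        rw [abs_of_nonneg (show 0 ≤ R by positivity)]
        calc |y - t * x| ≤ |y| + |t * x| := abs_sub _ _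
          _ = |y| + t * |x| := by rw [abs_mul, abs_of_nonneg ht]
          _ ≤ R := by rw [hR]; gcongr
      have h3 : 0 ≤ x ^ 2 / gM P ^ 2 := by positivity
      nlinarith [gk_pos R]
    · push Not at hx
      have : gM P ^ 2 ≤ x ^ 2 := by
        rw [← sq_abs x]; gcongr
      have h3 : 1 ≤ x ^ 2 / gM P ^ 2 := by rwa [one_le_div hM2]
      nlinarith [gk_pos R, gk_pos (y - t * x)]
  have hi : Integrable (fun x : ℝ => gk R * (1 - x ^ 2 / gM P ^ 2)) P :=
    ((integrable_const _).sub (h2.div_const _)).const_mul _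
  have h := integral_mono hi (int_gk t y) hpt
  rw [integral_const_mul, integral_sub (integrable_const _) (h2.div_const _), integral_div] at h
  simp only [integral_const, probReal_univ, smul_eq_mul, mul_one] at h
  have h4 : (∫ x : ℝ, x ^ 2 ∂P) / gM P ^ 2 ≤ 1 / 2 := by
    rw [div_le_iff₀ hM2, hM]; linarith
  change _ ≤ gG P t y at h
  nlinarith [gk_pos R]

lemma gG_pos (t y : ℝ) : 0 < gG P t y := by
  unfold gG
  rw [integral_pos_iff_support_of_nonneg (fun x => (gk_pos _).le) (int_gk t y)]
  have : (Function.support fun x => gk (y - t * x)) = Set.univ := by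
    ext x; simp [(gk_pos (y - t * x)).ne']
  rw [this]; simp

lemma log_gG_bound (h2 : Integrable (fun x : ℝ => x ^ 2) P) {t : ℝ} (ht : 0 ≤ t) (y : ℝ) :
    |Real.log (gG P t y)| ≤ Real.log 2 + |Real.log (√(2 * π))⁻¹| + y ^ 2 + (t * gM P) ^ 2 := by
  have hp := gG_pos (P := P) t y
  rw [abs_of_nonpos (Real.log_nonpos hp.le (gG_le_one t y))]
  have h := Real.log_le_log (gk_pos _) (gG_lower h2 ht y)
  rw [log_gk, Real.log_mul (by norm_num) hp.ne'] at h
  have := neg_abs_le (Real.log (√(2 * π))⁻¹)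
  nlinarith [sq_nonneg (|y| - t * gM P), sq_abs y]

lemma post_bound (h2 : Integrable (fun x : ℝ => x ^ 2) P) {t : ℝ} (ht : 0 < t) (y : ℝ) :
    gE P t (fun x => x ^ 2) y ≤
      (2 * |y| + t * gM P) ^ 2 / t ^ 2 + 2 * ∫ x, x ^ 2 ∂P := by
  unfold gE
  have hG := gG_pos (P := P) t y
  rw [div_le_iff₀ hG]
  set R := |y| + t * gM P with hR
  have hM0 := gM_nonneg (P := P)
  have hR0 : 0 ≤ R := by positivity
  have hpt : ∀ x : ℝ, x ^ 2 * gk (y - t * x) ≤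
      (2 * |y| + t * gM P) ^ 2 / t ^ 2 * gk (y - t * x) + x ^ 2 * gk R := by
    intro x
    by_cases hx : |y - t * x| ≤ R
    · have h1 : t * |x| ≤ 2 * |y| + t * gM P := by
        have : |t * x| ≤ |y| + |y - t * x| := by
          calc |t * x| = |y - (y - t * x)| := by ring_nf
            _ ≤ _ := abs_sub _ _
        rw [abs_mul, abs_of_pos ht] at this
        linarith
      have h3 : x ^ 2 ≤ (2 * |y| + t * gM P) ^ 2 / t ^ 2 := by
        rw [le_div_iff₀ (by positivity), ← sq_abs x, ← mul_pow, mul_comm]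
        gcongr
      have := mul_le_mul_of_nonneg_right h3 (gk_pos (y - t * x)).le
      have := mul_nonneg (sq_nonneg x) (gk_pos R).le
      linarith
    · push Not at hx
      have h1 : gk (y - t * x) ≤ gk R := gk_anti (by rw [abs_of_nonneg hR0]; exact hx.le)
      have := mul_le_mul_of_nonneg_left h1 (sq_nonneg x)
      have : 0 ≤ (2 * |y| + t * gM P) ^ 2 / t ^ 2 * gk (y - t * x) :=
        mul_nonneg (by positivity) (gk_pos _).le
      linarith
  have hi1 : Integrable (fun x => (2 * |y| + t * gM P) ^ 2 / t ^ 2 * gk (y - t * x)) P :=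
    (int_gk t y).const_mul _
  have h := integral_mono (int_mul_gk h2 t y) (hi1.add (h2.mul_const _)) hpt
  simp only [Pi.add_apply] at h
  rw [integral_add hi1 (h2.mul_const _), integral_const_mul, integral_mul_const] at h
  have hl := gG_lower h2 ht.le y
  have hm := m2_nonneg (P := P)
  change _ ≤ _ * gG P t y + _ at h
  nlinarith

lemma gE_nonneg {f : ℝ → ℝ} (hf : ∀ x, 0 ≤ f x) (t y : ℝ) : 0 ≤ gE P t f y :=
  div_nonneg (integral_nonneg fun x => mul_nonneg (hf x) (gk_pos _).le) (gG_pos t y).le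

lemma gE_add {f g : ℝ → ℝ} (hf : Integrable f P) (hg : Integrable g P) (t y : ℝ) :
    gE P t (fun x => f x + g x) y = gE P t f y + gE P t g y := by
  unfold gE
  rw [← add_div, ← integral_add (int_mul_gk hf t y) (int_mul_gk hg t y)]
  simp only [add_mul]

lemma gE_const_mul (f : ℝ → ℝ) (c t y : ℝ) :
    gE P t (fun x => c * f x) y = c * gE P t f y := by
  unfold gE
  rw [mul_div_assoc', ← integral_const_mul]
  simp only [mul_assoc]

lemma gE_const (c t y : ℝ) : gE P t (fun _ => c) y = c := by
  unfold gE
  rw [integral_const_mul, mul_div_assoc]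
  change c * (gG P t y / gG P t y) = c
  rw [div_self (gG_pos t y).ne', mul_one]

lemma gE_mono {f g : ℝ → ℝ} (hf : Integrable f P) (hg : Integrable g P) (h : ∀ x, f x ≤ g x)
    (t y : ℝ) : gE P t f y ≤ gE P t g y := by
  unfold gE
  have := (gG_pos (P := P) t y).le
  refine div_le_div_of_nonneg_right ?_ this
  exact integral_mono (int_mul_gk hf t y) (int_mul_gk hg t y)
    fun x => mul_le_mul_of_nonneg_right (h x) (gk_pos _).le

lemma gE_quad (h2 : Integrable (fun x : ℝ => x ^ 2) P) (a b c t y : ℝ) :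
    gE P t (fun x => a + b * x + c * x ^ 2) y =
      a + b * gE P t (fun x => x) y + c * gE P t (fun x => x ^ 2) y := by
  have h1 := int_id h2
  rw [gE_add (f := fun x => a + b * x) (g := fun x => c * x ^ 2)
      ((integrable_const _).add (h1.const_mul _)) (h2.const_mul _),
    gE_add (f := fun x => a) (g := fun x => b * x) (integrable_const _) (h1.const_mul _),
    gE_const, gE_const_mul, gE_const_mul]

lemma gE_sq_le (h2 : Integrable (fun x : ℝ => x ^ 2) P) (t y : ℝ) :
    gE P t (fun x => x) y ^ 2 ≤ gE P t (fun x => x ^ 2) y := by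
  set g := gE P t (fun x => x) y with hg
  have h := gE_nonneg (P := P) (f := fun x => g ^ 2 + (-2 * g) * x + 1 * x ^ 2)
    (fun x => by nlinarith [sq_nonneg (x - g)]) t y
  rw [gE_quad h2, ← hg] at h
  nlinarith

lemma gG_meas (t : ℝ) : Measurable (gG P t) := by
  have : StronglyMeasurable (fun y => ∫ x, gk (y - t * x) ∂P) :=
    StronglyMeasurable.integral_prod_right (f := fun y x => gk (y - t * x))
      (gk_meas.comp (by fun_prop)).stronglyMeasurable
  exact this.measurable

lemma gE_meas {f : ℝ → ℝ} (hf : Measurable f) (t : ℝ) : Measurable (gE P t f) := by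
  have : StronglyMeasurable (fun y => ∫ x, f x * gk (y - t * x) ∂P) :=
    StronglyMeasurable.integral_prod_right (f := fun y x => f x * gk (y - t * x))
      ((hf.comp measurable_snd).mul (gk_meas.comp (by fun_prop))).stronglyMeasurable
  exact this.measurable.div (gG_meas t)

lemma gG_hasDerivAt (h2 : Integrable (fun x : ℝ => x ^ 2) P) (x n t : ℝ) :
    HasDerivAt (fun t => gG P t (t * x + n))
      (∫ u, (-(t * x + n - t * u) * (x - u)) * gk (t * x + n - t * u) ∂P) t := by
  have h1 := int_id h2
  refine (hasDerivAt_integral_of_dominated_loc_of_deriv_le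
    (F := fun t u => gk (t * x + n - t * u))
    (F' := fun t u => (-(t * x + n - t * u) * (x - u)) * gk (t * x + n - t * u))
    (bound := fun u => |x - u|) Filter.univ_mem
    (Eventually.of_forall fun t => (gk_meas.comp (by fun_prop)).aestronglyMeasurable)
    (int_gk t _) ?_ ?_ ?_ ?_).2
  · exact (Measurable.mul (by fun_prop) (gk_meas.comp (by fun_prop))).aestronglyMeasurable
  · refine ae_of_all _ fun u s _ => ?_
    have h := gk_abs_mul_le (s * x + n - s * u)
    rw [norm_mul, norm_mul, Real.norm_of_nonneg (gk_pos _).le, norm_neg, Real.norm_eq_abs,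
      Real.norm_eq_abs]
    nlinarith [abs_nonneg (x - u)]
  · exact ((integrable_const _).sub h1).abs
  · refine ae_of_all _ fun u s _ => ?_
    have hi : HasDerivAt (fun s : ℝ => s * x + n - s * u) (x - u) s := by
      have := (((hasDerivAt_id s).mul_const x).add_const n).sub ((hasDerivAt_id s).mul_const u)
      refine this.congr_deriv (by simp)
    have := (gk_hasDerivAt (s * x + n - s * u)).comp s hi
    exact this.congr_deriv (by ring)

lemma log_gG_hasDerivAt (h2 : Integrable (fun x : ℝ => x ^ 2) P) (x n t : ℝ) :
    HasDerivAt (fun t => Real.log (gG P t (t * x + n)))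
      (-((t * x + n) * x) + (t * x + (t * x + n)) * gE P t (fun x => x) (t * x + n)
        + (-t) * gE P t (fun x => x ^ 2) (t * x + n)) t := by
  have h := (gG_hasDerivAt h2 x n t).log (gG_pos t _).ne'
  convert h using 1
  rw [← gE_quad h2]
  unfold gE
  congr 2
  ext u
  ring

end an

section prob
variable {Ω : Type*} [MeasurableSpace Ω] {μ : Measure Ω} [IsProbabilityMeasure μ]
  {X N : Ω → ℝ}

lemma joint_law (hX : Measurable X) (hN : Measurable N) (hXN : IndepFun X N μ)
    (hN_law : μ.map N = gaussianReal 0 1) (t : ℝ) :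
    μ.map (fun ω => (X ω, t * X ω + N ω)) =
      ((μ.map X).prod volume).withDensity (fun z => ENNReal.ofReal (gk (z.2 - t * z.1))) := by
  have := Measure.isProbabilityMeasure_map (μ := μ) hX.aemeasurable
  have hXNp := (indepFun_iff_map_prod_eq_prod_map_map hX.aemeasurable hN.aemeasurable).1 hXN
  have hgm : Measurable (fun z : ℝ × ℝ => ENNReal.ofReal (gk (z.2 - t * z.1))) :=
    (gk_meas.comp (by fun_prop)).ennreal_ofReal
  refine Measure.ext_of_lintegral _ fun f hf => ?_
  rw [lintegral_map hf (by fun_prop), lintegral_withDensity_eq_lintegral_mul _ hgm hf]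
  have h1 : ∫⁻ ω, f (X ω, t * X ω + N ω) ∂μ =
      ∫⁻ z, f (z.1, t * z.1 + z.2) ∂(μ.map (fun ω => (X ω, N ω))) := by
    rw [lintegral_map (by fun_prop) (by fun_prop)]
  rw [h1, hXNp, lintegral_prod _ (by fun_prop), lintegral_prod _ (by fun_prop)]
  congr 1 with x
  rw [hN_law, gaussianReal_of_var_ne_zero _ one_ne_zero,
    lintegral_withDensity_eq_lintegral_mul _ (by fun_prop) (by fun_prop)]
  refine Eq.trans ?_ (lintegral_add_left_eq_self _ (t * x))
  congr 1 with n
  simp [gaussianPDF, gk_eq]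

lemma out_law (hX : Measurable X) (hN : Measurable N) (hXN : IndepFun X N μ)
    (hN_law : μ.map N = gaussianReal 0 1) (t : ℝ) :
    μ.map (fun ω => t * X ω + N ω) =
      volume.withDensity (fun y => ENNReal.ofReal (gG (μ.map X) t y)) := by
  have := Measure.isProbabilityMeasure_map (μ := μ) hX.aemeasurable
  have hgm : Measurable (fun z : ℝ × ℝ => ENNReal.ofReal (gk (z.2 - t * z.1))) :=
    (gk_meas.comp (by fun_prop)).ennreal_ofReal
  have hGm : Measurable (fun y => ENNReal.ofReal (gG (μ.map X) t y)) := (gG_meas t).ennreal_ofReal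
  refine Measure.ext_of_lintegral _ fun f hf => ?_
  rw [lintegral_map hf (by fun_prop), lintegral_withDensity_eq_lintegral_mul _ hGm hf]
  have h1 : ∫⁻ ω, f (t * X ω + N ω) ∂μ =
      ∫⁻ z, f z.2 ∂(μ.map (fun ω => (X ω, t * X ω + N ω))) := by
    rw [lintegral_map (by fun_prop) (by fun_prop)]
  rw [h1, joint_law hX hN hXN hN_law,
    lintegral_withDensity_eq_lintegral_mul _ hgm (by fun_prop),
    lintegral_prod_symm _ (by fun_prop)]
  congr 1 with y
  simp only [Pi.mul_apply]
  have hm : Measurable (fun x => ENNReal.ofReal (gk (y - t * x))) :=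
    (gk_meas.comp (by fun_prop)).ennreal_ofReal
  rw [lintegral_mul_const _ hm, gG,
    ofReal_integral_eq_lintegral_ofReal (int_gk t y) (ae_of_all _ fun x => (gk_pos _).le)]

lemma tower (hX : Measurable X) (hN : Measurable N) (hXN : IndepFun X N μ)
    (hN_law : μ.map N = gaussianReal 0 1) (t : ℝ) {f : ℝ → ℝ} {h : ℝ → ℝ} (hf : Measurable f)
    (hh : Measurable h)
    (hi : Integrable (fun ω => f (X ω) * h (t * X ω + N ω)) μ) :
    Integrable (fun ω => gE (μ.map X) t f (t * X ω + N ω) * h (t * X ω + N ω)) μ ∧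
    ∫ ω, gE (μ.map X) t f (t * X ω + N ω) * h (t * X ω + N ω) ∂μ =
      ∫ ω, f (X ω) * h (t * X ω + N ω) ∂μ := by
  have := Measure.isProbabilityMeasure_map (μ := μ) hX.aemeasurable
  have hgm : Measurable (fun z : ℝ × ℝ => ENNReal.ofReal (gk (z.2 - t * z.1))) :=
    (gk_meas.comp (by fun_prop)).ennreal_ofReal
  have hGm : Measurable (fun y => ENNReal.ofReal (gG (μ.map X) t y)) := (gG_meas t).ennreal_ofReal
  have hEm := gE_meas (P := μ.map X) hf t
  have hYm : Measurable (fun ω => t * X ω + N ω) := by fun_prop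
  have hXYm : Measurable (fun ω => (X ω, t * X ω + N ω)) := by fun_prop
  have hfm : Measurable (fun z : ℝ × ℝ => f z.1 * h z.2) := by fun_prop
  have hem : Measurable (fun y : ℝ => gE (μ.map X) t f y * h y) := by fun_prop
  have hi2 : Integrable (fun z : ℝ × ℝ => f z.1 * h z.2)
      (μ.map (fun ω => (X ω, t * X ω + N ω))) := by
    rw [integrable_map_measure hfm.aestronglyMeasurable hXYm.aemeasurable]
    exact hi
  rw [joint_law hX hN hXN hN_law, integrable_withDensity_iff_integrable_smul' hgm
    (ae_of_all _ fun _ => ENNReal.ofReal_lt_top)] at hi2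
  have key : ∀ y, ∫ x, (ENNReal.ofReal (gk (y - t * x))).toReal • (f x * h y) ∂(μ.map X) =
      (ENNReal.ofReal (gG (μ.map X) t y)).toReal • (gE (μ.map X) t f y * h y) := by
    intro y
    rw [ENNReal.toReal_ofReal (gG_pos t y).le, gE, smul_eq_mul, ← mul_assoc,
      mul_div_cancel₀ _ (gG_pos t y).ne', ← integral_mul_const]
    congr 1 with x
    rw [ENNReal.toReal_ofReal (gk_pos _).le, smul_eq_mul]
    ring
  constructor
  · have h3 := hi2.integral_prod_right
    simp only [key] at h3
    rw [← integrable_withDensity_iff_integrable_smul' hGm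
      (ae_of_all _ fun _ => ENNReal.ofReal_lt_top), ← out_law hX hN hXN hN_law,
      integrable_map_measure hem.aestronglyMeasurable hYm.aemeasurable] at h3
    exact h3
  · have e1 := integral_map (μ := μ) hXYm.aemeasurable hfm.aestronglyMeasurable
    have e2 := integral_map (μ := μ) hYm.aemeasurable hem.aestronglyMeasurable
    rw [← e1, ← e2, joint_law hX hN hXN hN_law, out_law hX hN hXN hN_law,
      integral_withDensity_eq_integral_toReal_smul hgm
        (ae_of_all _ fun _ => ENNReal.ofReal_lt_top),
      integral_withDensity_eq_integral_toReal_smul hGm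
        (ae_of_all _ fun _ => ENNReal.ofReal_lt_top), integral_prod_symm _ hi2]
    simp only [key]

lemma int_N_sq (hN : Measurable N) (hN_law : μ.map N = gaussianReal 0 1) :
    Integrable (fun ω => N ω ^ 2) μ := by
  have h : Integrable (fun x : ℝ => x ^ 2) (gaussianReal 0 1) :=
    (memLp_id_gaussianReal 2).integrable_sq
  rw [← hN_law, integrable_map_measure (by fun_prop) hN.aemeasurable] at h
  exact h

lemma int_Y_sq (hX : Measurable X) (hN : Measurable N)
    (hX2 : Integrable (fun ω => X ω ^ 2) μ) (hN2 : Integrable (fun ω => N ω ^ 2) μ) (t : ℝ) :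
    Integrable (fun ω => (t * X ω + N ω) ^ 2) μ := by
  have h := ((hX2.const_mul (2 * t ^ 2)).add (hN2.const_mul 2))
  refine h.mono (by fun_prop) (ae_of_all _ fun ω => ?_)
  simp only [Pi.add_apply, Real.norm_eq_abs]
  rw [abs_of_nonneg (by positivity), abs_of_nonneg (by positivity)]
  nlinarith [sq_nonneg (t * X ω - N ω)]

lemma int_log_gG (hX : Measurable X) (hN : Measurable N)
    (hX2 : Integrable (fun ω => X ω ^ 2) μ) (hN2 : Integrable (fun ω => N ω ^ 2) μ)
    {t : ℝ} (ht : 0 ≤ t) :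
    Integrable (fun ω => Real.log (gG (μ.map X) t (t * X ω + N ω))) μ := by
  have := Measure.isProbabilityMeasure_map (μ := μ) hX.aemeasurable
  have h2 : Integrable (fun x : ℝ => x ^ 2) (μ.map X) := by
    rw [integrable_map_measure (by fun_prop) hX.aemeasurable]; exact hX2
  have hY := int_Y_sq hX hN hX2 hN2 t
  refine (((integrable_const (Real.log 2 + |Real.log (√(2 * π))⁻¹|)).add hY).add
    (integrable_const ((t * gM (μ.map X)) ^ 2))).mono'
    ((gG_meas (P := μ.map X) t).comp (by fun_prop)).log.aestronglyMeasurable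
    (ae_of_all _ fun ω => log_gG_bound h2 ht _)

lemma mi_eq (hX : Measurable X) (hN : Measurable N) (hXN : IndepFun X N μ)
    (hN_law : μ.map N = gaussianReal 0 1) (hX2 : Integrable (fun ω => X ω ^ 2) μ)
    {t : ℝ} (ht : 0 ≤ t) :
    (mutualInfo μ X (fun ω => t * X ω + N ω)).toReal =
      ∫ ω, Real.log (gk (N ω)) ∂μ - ∫ ω, Real.log (gG (μ.map X) t (t * X ω + N ω)) ∂μ := by
  have hPX := Measure.isProbabilityMeasure_map (μ := μ) hX.aemeasurable
  have hN2 := int_N_sq hN hN_law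
  have hgm : Measurable (fun z : ℝ × ℝ => ENNReal.ofReal (gk (z.2 - t * z.1))) :=
    (gk_meas.comp (by fun_prop)).ennreal_ofReal
  have hGm0 := gG_meas (P := μ.map X) t
  have hGm : Measurable (fun y => ENNReal.ofReal (gG (μ.map X) t y)) := hGm0.ennreal_ofReal
  have hGm2 : Measurable (fun z : ℝ × ℝ => ENNReal.ofReal (gG (μ.map X) t z.2)) := by fun_prop
  have hYm : Measurable (fun ω => t * X ω + N ω) := by fun_prop
  have hXYm : Measurable (fun ω => (X ω, t * X ω + N ω)) := by fun_prop
  have hPY := Measure.isProbabilityMeasure_map (μ := μ) hYm.aemeasurable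
  have hPXY := Measure.isProbabilityMeasure_map (μ := μ) hXYm.aemeasurable
  let r : ℝ × ℝ → ℝ := fun z => gk (z.2 - t * z.1) / gG (μ.map X) t z.2
  have hr0 : Measurable r := by
    have := gk_meas
    have : Measurable (fun z : ℝ × ℝ => gk (z.2 - t * z.1)) := gk_meas.comp (by fun_prop)
    exact this.div (hGm0.comp measurable_snd)
  have hr : Measurable (fun z => ENNReal.ofReal (r z)) := hr0.ennreal_ofReal
  have hJ : μ.map (fun ω => (X ω, t * X ω + N ω)) =
      ((μ.map X).prod (μ.map (fun ω => t * X ω + N ω))).withDensity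
        (fun z => ENNReal.ofReal (r z)) := by
    rw [joint_law hX hN hXN hN_law, out_law hX hN hXN hN_law, prod_withDensity_right hGm,
      ← withDensity_mul _ hGm2 hr]
    congr 1
    ext z
    simp only [Pi.mul_apply]
    rw [← ENNReal.ofReal_mul (gG_pos t _).le, mul_div_cancel₀ _ (gG_pos t _).ne']
  set J := μ.map (fun ω => (X ω, t * X ω + N ω)) with hJdef
  set Q := (μ.map X).prod (μ.map (fun ω => t * X ω + N ω)) with hQdef
  have hac : J ≪ Q := by rw [hJ]; exact withDensity_absolutelyContinuous _ _
  have hllr : llr J Q =ᵐ[J] fun z => Real.log (gk (z.2 - t * z.1)) - Real.log (gG (μ.map X) t z.2) := by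
    have h1 : J.rnDeriv Q =ᵐ[Q] fun z => ENNReal.ofReal (r z) := by
      rw [hJ]; exact Measure.rnDeriv_withDensity _ hr
    filter_upwards [hac.ae_le h1] with z hz
    rw [llr, hz, ENNReal.toReal_ofReal (div_nonneg (gk_pos _).le (gG_pos t _).le),
      Real.log_div (gk_pos _).ne' (gG_pos t _).ne']
  have hm1 : Measurable (fun z : ℝ × ℝ =>
      Real.log (gk (z.2 - t * z.1)) - Real.log (gG (μ.map X) t z.2)) :=
    (gk_meas.comp (by fun_prop)).log.sub (hGm0.comp measurable_snd).log
  have hiG := int_log_gG hX hN hX2 hN2 ht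
  have hiN : Integrable (fun ω => Real.log (gk (N ω))) μ := by
    simp only [log_gk]
    exact (integrable_const _).sub (hN2.div_const _)
  have hsimp : ∀ ω, t * X ω + N ω - t * X ω = N ω := fun ω => by ring
  have hint : Integrable (llr J Q) J := by
    rw [integrable_congr hllr, hJdef, integrable_map_measure hm1.aestronglyMeasurable
      hXYm.aemeasurable]
    simp only [Function.comp_def, hsimp]
    exact hiN.sub hiG
  have hval : ∫ z, llr J Q z ∂J =
      ∫ ω, Real.log (gk (N ω)) ∂μ - ∫ ω, Real.log (gG (μ.map X) t (t * X ω + N ω)) ∂μ := by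
    rw [integral_congr_ae hllr, hJdef, integral_map hXYm.aemeasurable hm1.aestronglyMeasurable]
    simp only [hsimp]
    rw [integral_sub hiN hiG]
  have hnn : 0 ≤ ∫ z, llr J Q z ∂J := by
    have := InformationTheory.integral_llr_add_sub_measure_univ_nonneg hac hint
    simpa using this
  unfold mutualInfo klDiv
  rw [← hJdef, ← hQdef, if_pos ⟨hac, hint⟩, ENNReal.toReal_ofReal hnn, hval]

lemma int_mul_of_sq {f g : Ω → ℝ} (hf : AEStronglyMeasurable f μ) (hg : AEStronglyMeasurable g μ)
    (hf2 : Integrable (fun ω => f ω ^ 2) μ) (hg2 : Integrable (fun ω => g ω ^ 2) μ) :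
    Integrable (fun ω => f ω * g ω) μ := by
  refine (hf2.add hg2).mono' (hf.mul hg) (ae_of_all _ fun ω => ?_)
  simp only [Pi.add_apply, Real.norm_eq_abs, abs_mul]
  nlinarith [sq_nonneg (|f ω| - |g ω|), sq_abs (f ω), sq_abs (g ω)]

lemma int_of_sq {f : Ω → ℝ} (hf : AEStronglyMeasurable f μ)
    (hf2 : Integrable (fun ω => f ω ^ 2) μ) : Integrable f μ := by
  simpa using int_mul_of_sq hf (aestronglyMeasurable_const (b := (1 : ℝ))) hf2 (by simp)

lemma int_gE2 (hX : Measurable X) (hN : Measurable N) (hXN : IndepFun X N μ)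
    (hN_law : μ.map N = gaussianReal 0 1) (hX2 : Integrable (fun ω => X ω ^ 2) μ) (t : ℝ) :
    Integrable (fun ω => gE (μ.map X) t (fun x => x) (t * X ω + N ω) ^ 2) μ := by
  have := Measure.isProbabilityMeasure_map (μ := μ) hX.aemeasurable
  have h2 : Integrable (fun x : ℝ => x ^ 2) (μ.map X) := by
    rw [integrable_map_measure (by fun_prop) hX.aemeasurable]; exact hX2
  have h := (tower hX hN hXN hN_law t (f := fun x => x ^ 2) (h := fun _ => 1) (by fun_prop)
    (by fun_prop) (by simpa using hX2)).1
  simp only [mul_one] at h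
  have hEm : Measurable (gE (μ.map X) t (fun x => x)) := gE_meas measurable_id t
  have hEm2 : Measurable (fun ω => gE (μ.map X) t (fun x => x) (t * X ω + N ω)) :=
    hEm.comp (by fun_prop)
  refine h.mono' (hEm2.pow_const 2).aestronglyMeasurable (ae_of_all _ fun ω => ?_)
  rw [Real.norm_of_nonneg (sq_nonneg _)]
  exact gE_sq_le h2 _ _

lemma mmse_eq (hX : Measurable X) (hN : Measurable N) (hXN : IndepFun X N μ)
    (hN_law : μ.map N = gaussianReal 0 1) (hX2 : Integrable (fun ω => X ω ^ 2) μ) (t : ℝ) :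
    mmse μ X (fun ω => t * X ω + N ω) =
      ∫ ω, X ω ^ 2 ∂μ - ∫ ω, gE (μ.map X) t (fun x => x) (t * X ω + N ω) ^ 2 ∂μ := by
  have := Measure.isProbabilityMeasure_map (μ := μ) hX.aemeasurable
  have hEm : Measurable (gE (μ.map X) t (fun x => x)) := gE_meas measurable_id t
  have hg2 := int_gE2 hX hN hXN hN_law hX2 t
  have hYm : Measurable (fun ω => t * X ω + N ω) := by fun_prop
  have hgm : Measurable (fun ω => gE (μ.map X) t (fun x => x) (t * X ω + N ω)) := by fun_prop
  have hXi := int_of_sq hX.aestronglyMeasurable hX2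
  have hgi := int_of_sq hgm.aestronglyMeasurable hg2
  have hXg := int_mul_of_sq hX.aestronglyMeasurable hgm.aestronglyMeasurable hX2 hg2
  have hce : (fun ω => gE (μ.map X) t (fun x => x) (t * X ω + N ω)) =ᵐ[μ]
      μ[X | MeasurableSpace.comap (fun ω => t * X ω + N ω) inferInstance] := by
    refine ae_eq_condExp_of_forall_setIntegral_eq hYm.comap_le hXi
      (fun s _ _ => hgi.integrableOn) ?_ ?_
    · rintro s ⟨B, hB, rfl⟩ -
      have hBm : Measurable (B.indicator (fun _ => (1 : ℝ))) := measurable_const.indicator hB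
      have e : ∀ F : Ω → ℝ, ∫ ω in (fun ω => t * X ω + N ω) ⁻¹' B, F ω ∂μ =
          ∫ ω, F ω * B.indicator (fun _ => (1 : ℝ)) (t * X ω + N ω) ∂μ := by
        intro F
        rw [← integral_indicator (hYm hB)]
        congr 1 with ω
        by_cases hω : t * X ω + N ω ∈ B
        · rw [Set.indicator_of_mem (show ω ∈ (fun ω => t * X ω + N ω) ⁻¹' B from hω),
            Set.indicator_of_mem hω, mul_one]
        · rw [Set.indicator_of_notMem (show ω ∉ (fun ω => t * X ω + N ω) ⁻¹' B from hω),
            Set.indicator_of_notMem hω, mul_zero]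
      rw [e, e]
      refine (tower hX hN hXN hN_law t (f := fun x => x) measurable_id hBm ?_).2
      refine hXi.mono (by fun_prop) (ae_of_all _ fun ω => ?_)
      rw [norm_mul]
      refine mul_le_of_le_one_right (norm_nonneg _) ?_
      by_cases hω : t * X ω + N ω ∈ B <;> simp [hω]
    · refine StronglyMeasurable.aestronglyMeasurable (Measurable.stronglyMeasurable ?_)
      exact hEm.comp (comap_measurable _)
  have e1 : mmse μ X (fun ω => t * X ω + N ω) =
      ∫ ω, (X ω - gE (μ.map X) t (fun x => x) (t * X ω + N ω)) ^ 2 ∂μ := by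
    unfold mmse
    refine integral_congr_ae ?_
    filter_upwards [hce] with ω hω
    rw [← hω]
  have e2 := (tower hX hN hXN hN_law t (f := fun x => x) measurable_id hEm hXg).2
  have e3 : ∀ ω, (X ω - gE (μ.map X) t (fun x => x) (t * X ω + N ω)) ^ 2 =
    X ω ^ 2 - 2 * (X ω * gE (μ.map X) t (fun x => x) (t * X ω + N ω))
      + gE (μ.map X) t (fun x => x) (t * X ω + N ω) ^ 2 := fun ω => by ring
  rw [e1]
  simp only [e3]
  have a1 : Integrable (fun ω => X ω ^ 2 - 2 *
      (X ω * gE (μ.map X) t (fun x => x) (t * X ω + N ω))) μ := hX2.sub (hXg.const_mul 2)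
  rw [integral_add a1 hg2, integral_sub hX2 (hXg.const_mul 2),
    integral_const_mul, ← e2]
  simp only [← pow_two]
  ring

lemma deriv_log_gG (hX : Measurable X) (hN : Measurable N) (hXN : IndepFun X N μ)
    (hN_law : μ.map N = gaussianReal 0 1) (hX2 : Integrable (fun ω => X ω ^ 2) μ)
    {t : ℝ} (ht : 0 < t) :
    HasDerivAt (fun t => ∫ ω, Real.log (gG (μ.map X) t (t * X ω + N ω)) ∂μ)
      (-(t * (∫ ω, X ω ^ 2 ∂μ - ∫ ω, gE (μ.map X) t (fun x => x) (t * X ω + N ω) ^ 2 ∂μ))) t := by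
  have := Measure.isProbabilityMeasure_map (μ := μ) hX.aemeasurable
  have h2 : Integrable (fun x : ℝ => x ^ 2) (μ.map X) := by
    rw [integrable_map_measure (by fun_prop) hX.aemeasurable]; exact hX2
  have hEm : Measurable (gE (μ.map X) t (fun x => x)) := gE_meas measurable_id t
  have hEm2 : Measurable (gE (μ.map X) t (fun x => x ^ 2)) := gE_meas (by fun_prop) t
  have hN2 := int_N_sq hN hN_law
  have hg2 := int_gE2 hX hN hXN hN_law hX2 t
  have hY2 := int_Y_sq hX hN hX2 hN2 t
  have hYm : Measurable (fun ω => t * X ω + N ω) := by fun_prop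
  have hgm : Measurable (fun ω => gE (μ.map X) t (fun x => x) (t * X ω + N ω)) := by fun_prop
  have hXg := int_mul_of_sq hX.aestronglyMeasurable hgm.aestronglyMeasurable hX2 hg2
  have hXY := int_mul_of_sq hX.aestronglyMeasurable hYm.aestronglyMeasurable hX2 hY2
  have e1 := (tower hX hN hXN hN_law t (f := fun x => x) measurable_id hEm hXg).2
  obtain ⟨i2, e2⟩ := (tower hX hN hXN hN_law t (f := fun x => x) measurable_id measurable_id hXY)
  obtain ⟨i3, e3⟩ := tower hX hN hXN hN_law t (f := fun x => x ^ 2) (h := fun _ => 1) (by fun_prop)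
    (by fun_prop) (by simpa using hX2)
  simp only [mul_one, id] at e2 e3 i2 i3
  have hs : Set.Ioo (t / 2) (2 * t) ∈ 𝓝 t := Ioo_mem_nhds (by linarith) (by linarith)
  set M := gM (μ.map X) with hM
  have hM0 : 0 ≤ M := gM_nonneg
  set m2 := ∫ x, x ^ 2 ∂(μ.map X) with hm2
  have hm0 : 0 ≤ m2 := m2_nonneg
  -- bound
  let Yb : Ω → ℝ := fun ω => 8 * t ^ 2 * X ω ^ 2 + 2 * N ω ^ 2
  have hYb : Integrable Yb μ := (hX2.const_mul _).add (hN2.const_mul _)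
  let bd : Ω → ℝ := fun ω => 2 * (Yb ω + X ω ^ 2 +
    (1 + 4 * t ^ 2) * ((8 * Yb ω + 2 * (2 * t * M) ^ 2) / (t / 2) ^ 2 + 2 * m2))
  have hbd : Integrable bd μ :=
    ((hYb.add hX2).add (((((hYb.const_mul 8).add (integrable_const _)).div_const _).add
      (integrable_const _)).const_mul _)).const_mul 2
  have hder := hasDerivAt_integral_of_dominated_loc_of_deriv_le (μ := μ)
    (F := fun t ω => Real.log (gG (μ.map X) t (t * X ω + N ω)))
    (F' := fun t ω => (-((t * X ω + N ω) * X ω) + (t * X ω + (t * X ω + N ω)) *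
      gE (μ.map X) t (fun x => x) (t * X ω + N ω)
        + (-t) * gE (μ.map X) t (fun x => x ^ 2) (t * X ω + N ω)))
    (bound := bd) hs
    (Eventually.of_forall fun t =>
      ((gG_meas (P := μ.map X) t).comp (by fun_prop)).log.aestronglyMeasurable)
    (int_log_gG hX hN hX2 hN2 ht.le)
    (by fun_prop) ?_ hbd (ae_of_all _ fun ω s _ => log_gG_hasDerivAt h2 (X ω) (N ω) s)
  · refine hder.2.congr_deriv ?_
    have e4 : ∀ ω, (-((t * X ω + N ω) * X ω) + (t * X ω + (t * X ω + N ω)) *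
      gE (μ.map X) t (fun x => x) (t * X ω + N ω)
        + (-t) * gE (μ.map X) t (fun x => x ^ 2) (t * X ω + N ω)) =
        -(X ω * (t * X ω + N ω)) + t * (X ω * gE (μ.map X) t (fun x => x) (t * X ω + N ω))
        + gE (μ.map X) t (fun x => x) (t * X ω + N ω) * (t * X ω + N ω)
        + (-t) * gE (μ.map X) t (fun x => x ^ 2) (t * X ω + N ω) := fun ω => by ring
    simp only [e4]
    have a1 : Integrable (fun ω => -(X ω * (t * X ω + N ω))) μ := hXY.neg
    have a2 := hXg.const_mul t
    have a4 := i3.const_mul (-t)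
    have a5 : Integrable (fun ω => -(X ω * (t * X ω + N ω)) +
        t * (X ω * gE (μ.map X) t (fun x => x) (t * X ω + N ω))) μ := a1.add a2
    have a6 : Integrable (fun ω => -(X ω * (t * X ω + N ω)) +
        t * (X ω * gE (μ.map X) t (fun x => x) (t * X ω + N ω)) +
        gE (μ.map X) t (fun x => x) (t * X ω + N ω) * (t * X ω + N ω)) μ := a5.add i2
    rw [integral_add a6 a4, integral_add a5 i2, integral_add a1 a2,
      integral_neg, integral_const_mul, integral_const_mul, e2, e3, ← e1]
    simp only [← pow_two]
    ring
  · refine ae_of_all _ fun ω s hs => ?_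
    have hs0 : 0 < s := by linarith [hs.1]
    have hs1 : t / 2 ≤ s := hs.1.le
    have hs2 : s ≤ 2 * t := hs.2.le
    set y := s * X ω + N ω with hy
    have hsq : s ^ 2 ≤ 4 * t ^ 2 := by nlinarith
    have hyb : y ^ 2 ≤ Yb ω := by
      have : s ^ 2 * X ω ^ 2 ≤ 4 * t ^ 2 * X ω ^ 2 := by gcongr
      simp only [Yb]
      nlinarith [sq_nonneg (s * X ω - N ω)]
    have hv := post_bound h2 hs0 y
    rw [← hM, ← hm2] at hv
    have hg := gE_sq_le h2 s y
    set g := gE (μ.map X) s (fun x => x) y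
    set v := gE (μ.map X) s (fun x => x ^ 2) y
    have hv2 : v ≤ (8 * Yb ω + 2 * (2 * t * M) ^ 2) / (t / 2) ^ 2 + 2 * m2 := by
      refine hv.trans ?_
      gcongr
      have : (s * M) ^ 2 ≤ (2 * t * M) ^ 2 := by gcongr
      nlinarith [sq_nonneg (2 * |y| - s * M), sq_abs y]
    have hv0 : 0 ≤ v := (sq_nonneg g).trans hg
    have hb1 : |(-(y * X ω) + (s * X ω + y) * g + -s * v)| ≤
        2 * (y ^ 2 + X ω ^ 2 + (1 + s ^ 2) * v) := by
      have k1 : s ^ 2 * g ^ 2 ≤ s ^ 2 * v := by gcongr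
      have k2 : 0 ≤ s ^ 2 * v := by positivity
      have k3 : s * v ≤ (1 + s ^ 2) * v := by
        gcongr; nlinarith [sq_nonneg (s - 1)]
      have k4 : 0 ≤ s * v := by positivity
      rw [abs_le]
      constructor
      · nlinarith [sq_nonneg (y - X ω), sq_nonneg (y + X ω), sq_nonneg (X ω + s * g),
          sq_nonneg (X ω - s * g), sq_nonneg (y - g), sq_nonneg (y + g)]
      · nlinarith [sq_nonneg (y - X ω), sq_nonneg (y + X ω), sq_nonneg (X ω + s * g),
          sq_nonneg (X ω - s * g), sq_nonneg (y - g), sq_nonneg (y + g)]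
    rw [Real.norm_eq_abs]
    refine hb1.trans ?_
    simp only [bd]
    gcongr

end prob

/-- **I-MMSE relation** (Guo–Shamai–Verdú, Theorem 1): for the scalar Gaussian channel
`Y = √snr · X + N` with `E[X²] < ∞`, the mutual information `snr ↦ I(snr)` is differentiable
on `(0, ∞)` with derivative equal to half the minimum mean-square error. -/
theorem hasDerivAt_mutualInfo_half_mmse
    {Ω : Type*} [MeasurableSpace Ω] (μ : Measure Ω) [IsProbabilityMeasure μ]
    (X N : Ω → ℝ) (hX : Measurable X) (hN : Measurable N)
    (hXN : IndepFun X N μ)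
    (hN_law : μ.map N = gaussianReal 0 1)
    (hX2 : Integrable (fun ω => X ω ^ 2) μ) :
    ∀ snr ∈ Set.Ioi (0 : ℝ),
      HasDerivAt (fun s : ℝ => (mutualInfo μ X (chOut X N s)).toReal)
        (mmse μ X (chOut X N snr) / 2) snr := by
  intro snr hsnr
  have hs : 0 < snr := hsnr
  have hd := deriv_log_gG hX hN hXN hN_law hX2 (Real.sqrt_pos.2 hs)
  have h1 := (hd.comp snr (Real.hasDerivAt_sqrt hs.ne')).const_sub (∫ ω, Real.log (gk (N ω)) ∂μ)
  have h2 : HasDerivAt (fun s : ℝ => (mutualInfo μ X (chOut X N s)).toReal) _ snr :=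
    h1.congr_of_eventuallyEq
      (Eventually.of_forall fun s => mi_eq hX hN hXN hN_law hX2 (Real.sqrt_nonneg s))
  refine h2.congr_deriv ?_
  rw [← mmse_eq hX hN hXN hN_law hX2]
  have h3 := (Real.sqrt_pos.2 hs).ne'
  change _ = mmse μ X (fun ω => √snr * X ω + N ω) / 2
  field_simp
end
end

section
/- As δ → 0⁺, the input–output mutual information of the canonical Gaussian channel Y = √δ · Z + U satisfies I(Z; Y) = (δ/2) · E[(Z − E[Z])^2] + o(δ); equivalently, lim_{δ→0⁺} I(Z; √δ · Z + U)/δ = (1/2) · Var(Z). -/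
open MeasureTheory ProbabilityTheory Real Filter
open scoped ENNReal NNReal Topology

noncomputable section

def Lk (s w y : ℝ) : ℝ := rexp (s * w * y - s ^ 2 * w ^ 2 / 2)

def Mk (P : Measure ℝ) (s y : ℝ) : ℝ := ∫ w, Lk s w y ∂P

lemma Lk_pos (s w y : ℝ) : 0 < Lk s w y := Real.exp_pos _

lemma Lk_le (s w y : ℝ) : Lk s w y ≤ rexp (y ^ 2 / 2) := by
  unfold Lk
  apply Real.exp_le_exp.mpr
  nlinarith [sq_nonneg (y - s * w)]

@[fun_prop]
lemma measurable_Lk {α : Type*} [MeasurableSpace α] (s : ℝ) {f g : α → ℝ} (hf : Measurable f)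
    (hg : Measurable g) : Measurable (fun a => Lk s (f a) (g a)) := by
  unfold Lk; fun_prop

lemma integrable_Lk (P : Measure ℝ) [IsProbabilityMeasure P] (s y : ℝ) :
    Integrable (fun w => Lk s w y) P := by
  refine Integrable.of_bound (by fun_prop) (rexp (y ^ 2 / 2)) (ae_of_all _ fun w => ?_)
  rw [Real.norm_of_nonneg (Lk_pos _ _ _).le]
  exact Lk_le s w y

lemma Mk_le (P : Measure ℝ) [IsProbabilityMeasure P] (s y : ℝ) : Mk P s y ≤ rexp (y ^ 2 / 2) := by
  calc Mk P s y ≤ ∫ _, rexp (y ^ 2 / 2) ∂P :=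
        integral_mono (integrable_Lk P s y) (integrable_const _) fun w => Lk_le s w y
    _ = _ := by simp

lemma Mk_pos (P : Measure ℝ) [IsProbabilityMeasure P] (s y : ℝ) : 0 < Mk P s y :=
  integral_exp_pos (integrable_Lk P s y)

lemma Mk_ge (P : Measure ℝ) [IsProbabilityMeasure P] (h1 : Integrable (fun w => w) P)
    (h2 : Integrable (fun w => w ^ 2) P) (h0 : ∫ w, w ∂P = 0) (s y : ℝ) :
    rexp (-(s ^ 2 * (∫ w, w ^ 2 ∂P) / 2)) ≤ Mk P s y := by
  set c := -(s ^ 2 * (∫ w, w ^ 2 ∂P) / 2) with hc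
  have hi : Integrable (fun w => s * y * w - s ^ 2 / 2 * w ^ 2) P :=
    (h1.const_mul _).sub (h2.const_mul _)
  have hI : ∫ w, (s * y * w - s ^ 2 / 2 * w ^ 2) ∂P = c := by
    rw [integral_sub (h1.const_mul _) (h2.const_mul _), integral_const_mul, integral_const_mul, h0, hc]
    ring
  calc rexp c = ∫ w, rexp c * (1 + ((s * y * w - s ^ 2 / 2 * w ^ 2) - c)) ∂P := by
        have hi' : Integrable (fun w => s * y * w - s ^ 2 / 2 * w ^ 2 - c) P :=
          hi.sub (integrable_const _)
        rw [integral_const_mul, integral_add (integrable_const _) hi',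
          integral_sub hi (integrable_const _), hI]
        simp
    _ ≤ _ := by
        refine integral_mono (((integrable_const _).add (hi.sub (integrable_const _))).const_mul _)
          (integrable_Lk P s y) fun w => ?_
        have : Lk s w y = rexp c * rexp ((s * y * w - s ^ 2 / 2 * w ^ 2) - c) := by
          rw [← Real.exp_add, Lk]; congr 1; ring
        simp only [this]
        gcongr
        linarith [Real.add_one_le_exp ((s * y * w - s ^ 2 / 2 * w ^ 2) - c)]

@[fun_prop]
lemma measurable_Mk (P : Measure ℝ) [IsProbabilityMeasure P] (s : ℝ) : Measurable (Mk P s) := by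
  have : StronglyMeasurable (fun p : ℝ × ℝ => Lk s p.1 p.2) :=
    Measurable.stronglyMeasurable (by fun_prop)
  exact this.integral_prod_left'.measurable

lemma hasDerivAt_Lk (s w y : ℝ) : HasDerivAt (fun s => Lk s w y) ((w * y - s * w ^ 2) * Lk s w y) s := by
  unfold Lk
  have : HasDerivAt (fun s : ℝ => s * w * y - s ^ 2 * w ^ 2 / 2) (w * y - s * w ^ 2) s := by
    have h1 := (((hasDerivAt_id s).mul_const w).mul_const y)
    have h2 := (((hasDerivAt_pow 2 s).mul_const (w ^ 2)).div_const 2)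
    refine (h1.sub h2).congr_deriv ?_
    simp; ring
  refine this.exp.congr_deriv ?_
  ring

lemma hasDerivAt_Mk (P : Measure ℝ) [IsProbabilityMeasure P] (h1 : Integrable (fun w => w) P)
    (h0 : ∫ w, w ∂P = 0) (y : ℝ) : HasDerivAt (fun s => Mk P s y) 0 0 := by
  have := (hasDerivAt_integral_of_dominated_loc_of_deriv_le (μ := P) (x₀ := (0 : ℝ))
    (F := fun s w => Lk s w y) (F' := fun s w => (w * y - s * w ^ 2) * Lk s w y)
    (s := Set.univ) (bound := fun w => |w| * rexp (y ^ 2 / 2)) Filter.univ_mem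
    (Filter.Eventually.of_forall fun s => by fun_prop) (integrable_Lk P 0 y)
    (by fun_prop) (ae_of_all _ fun w s _ => ?_) (h1.abs.mul_const _)
    (ae_of_all _ fun w s _ => hasDerivAt_Lk s w y)).2
  · refine this.congr_deriv ?_
    simp [Lk, integral_mul_const, h0]
  · have e1 : w * y - s * w ^ 2 = w * (y - s * w) := by ring
    have e2 : Lk s w y = rexp (y ^ 2 / 2) * rexp (-((y - s * w) ^ 2 / 2)) := by
      rw [← Real.exp_add, Lk]; congr 1; ring
    rw [Real.norm_eq_abs, abs_mul, abs_of_pos (Lk_pos _ _ _), e1, e2, abs_mul]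
    have e3 : |y - s * w| * rexp (-((y - s * w) ^ 2 / 2)) ≤ 1 := by
      rw [Real.exp_neg, ← div_eq_mul_inv, div_le_one (Real.exp_pos _)]
      have := Real.add_one_le_exp ((y - s * w) ^ 2 / 2)
      rw [← sq_abs] at this ⊢
      nlinarith [sq_nonneg (|y - s * w| - 1)]
    calc |w| * |y - s * w| * (rexp (y ^ 2 / 2) * rexp (-((y - s * w) ^ 2 / 2)))
        = (|w| * rexp (y ^ 2 / 2)) * (|y - s * w| * rexp (-((y - s * w) ^ 2 / 2))) := by ring
      _ ≤ (|w| * rexp (y ^ 2 / 2)) * 1 := by gcongr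
      _ = _ := mul_one _

lemma gaussian_shift (a : ℝ) : (gaussianReal 0 1).map (fun u => a + u) =
    (gaussianReal 0 1).withDensity (fun y => ENNReal.ofReal (rexp (a * y - a ^ 2 / 2))) := by
  rw [gaussianReal_map_const_add, gaussianReal_of_var_ne_zero _ one_ne_zero,
    gaussianReal_of_var_ne_zero _ one_ne_zero,
    ← withDensity_mul _ (measurable_gaussianPDF _ _) (by fun_prop)]
  congr 1
  ext y
  simp only [gaussianPDF, Pi.mul_apply]
  rw [← ENNReal.ofReal_mul (gaussianPDFReal_nonneg _ _ _)]
  congr 1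
  simp only [gaussianPDFReal]
  rw [mul_assoc (√_)⁻¹, ← Real.exp_add]
  congr 2
  simp; ring

lemma joint_law_s3 (P : Measure ℝ) [IsProbabilityMeasure P] (s : ℝ) :
    (P.prod (gaussianReal 0 1)).map (fun p => (p.1, s * p.1 + p.2)) =
    (P.prod (gaussianReal 0 1)).withDensity (fun p => ENNReal.ofReal (Lk s p.1 p.2)) := by
  refine Measure.ext_of_lintegral _ fun f hf => ?_
  rw [lintegral_map hf (by fun_prop), lintegral_withDensity_eq_lintegral_mul _ (by fun_prop) hf,
    lintegral_prod _ (by fun_prop), lintegral_prod _ (by fun_prop)]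
  refine lintegral_congr fun z => ?_
  have := gaussian_shift (s * z)
  have h2 : ∫⁻ y, f (z, y) ∂((gaussianReal 0 1).map (fun u => s * z + u)) =
      ∫⁻ u, f (z, s * z + u) ∂(gaussianReal 0 1) := lintegral_map (by fun_prop) (by fun_prop)
  rw [← h2, this, lintegral_withDensity_eq_lintegral_mul _ (by fun_prop) (by fun_prop)]
  refine lintegral_congr fun y => ?_
  simp [Lk, mul_pow]

lemma marg_law (P : Measure ℝ) [IsProbabilityMeasure P] (s : ℝ) :
    (P.prod (gaussianReal 0 1)).map (fun p => s * p.1 + p.2) =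
    (gaussianReal 0 1).withDensity (fun y => ENNReal.ofReal (Mk P s y)) := by
  have : (P.prod (gaussianReal 0 1)).map (fun p => s * p.1 + p.2) =
      ((P.prod (gaussianReal 0 1)).map (fun p => (p.1, s * p.1 + p.2))).map Prod.snd := by
    rw [Measure.map_map (by fun_prop) (by fun_prop)]; rfl
  rw [this, joint_law_s3]
  refine Measure.ext_of_lintegral _ fun f hf => ?_
  rw [lintegral_map hf (by fun_prop), lintegral_withDensity_eq_lintegral_mul _ (by fun_prop) (by fun_prop),
    lintegral_withDensity_eq_lintegral_mul _ (by fun_prop) hf, lintegral_prod_symm _ (by fun_prop)]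
  refine lintegral_congr fun y => ?_
  simp only [Pi.mul_apply]
  rw [lintegral_mul_const _ (by fun_prop), Mk, ofReal_integral_eq_lintegral_ofReal (integrable_Lk P s y)
    (ae_of_all _ fun w => (Lk_pos _ _ _).le)]

/-- joint and product laws -/
def Jm (P : Measure ℝ) (s : ℝ) : Measure (ℝ × ℝ) :=
  (P.prod (gaussianReal 0 1)).map (fun p => (p.1, s * p.1 + p.2))
def Ym (P : Measure ℝ) (s : ℝ) : Measure ℝ :=
  (P.prod (gaussianReal 0 1)).map (fun p => s * p.1 + p.2)

instance (P : Measure ℝ) [IsProbabilityMeasure P] (s : ℝ) : IsProbabilityMeasure (Jm P s) :=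
  Measure.isProbabilityMeasure_map (by fun_prop)
instance (P : Measure ℝ) [IsProbabilityMeasure P] (s : ℝ) : IsProbabilityMeasure (Ym P s) :=
  Measure.isProbabilityMeasure_map (by fun_prop)

lemma Q_eq (P : Measure ℝ) [IsProbabilityMeasure P] (s : ℝ) : P.prod (Ym P s) =
    (P.prod (gaussianReal 0 1)).withDensity (fun p => ENNReal.ofReal (Mk P s p.2)) := by
  rw [Ym, marg_law, prod_withDensity_right (by fun_prop)]

lemma J_eq (P : Measure ℝ) [IsProbabilityMeasure P] (s : ℝ) : Jm P s =
    (P.prod (Ym P s)).withDensity (fun p => ENNReal.ofReal (Lk s p.1 p.2 / Mk P s p.2)) := by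
  rw [Q_eq, Jm, joint_law_s3, ← withDensity_mul _ (by fun_prop) (by fun_prop)]
  congr 1
  ext p
  simp only [Pi.mul_apply]
  rw [← ENNReal.ofReal_mul (Mk_pos _ _ _).le, mul_div_cancel₀ _ (Mk_pos _ _ _).ne']

lemma J_ac (P : Measure ℝ) [IsProbabilityMeasure P] (s : ℝ) : Jm P s ≪ P.prod (Ym P s) := by
  rw [J_eq]; exact withDensity_absolutelyContinuous _ _

lemma J_rn (P : Measure ℝ) [IsProbabilityMeasure P] (s : ℝ) :
    (Jm P s).rnDeriv (P.prod (Ym P s)) =ᵐ[P.prod (Ym P s)]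
      fun p => ENNReal.ofReal (Lk s p.1 p.2 / Mk P s p.2) := by
  conv_lhs => rw [J_eq]
  exact Measure.rnDeriv_withDensity _ (by fun_prop)

lemma J_llr (P : Measure ℝ) [IsProbabilityMeasure P] (s : ℝ) :
    llr (Jm P s) (P.prod (Ym P s)) =ᵐ[Jm P s]
      fun p => (s * p.1 * p.2 - s ^ 2 * p.1 ^ 2 / 2) - Real.log (Mk P s p.2) := by
  filter_upwards [(J_ac P s).ae_le (J_rn P s)] with p hp
  rw [llr, hp, ENNReal.toReal_ofReal (div_pos (Lk_pos _ _ _) (Mk_pos _ _ _)).le,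
    Real.log_div (Lk_pos _ _ _).ne' (Mk_pos _ _ _).ne', Lk, Real.log_exp]

lemma Y_llr (P : Measure ℝ) [IsProbabilityMeasure P] (s : ℝ) : Ym P s ≪ gaussianReal 0 1 ∧
    llr (Ym P s) (gaussianReal 0 1) =ᵐ[Ym P s] fun y => Real.log (Mk P s y) := by
  have hac : Ym P s ≪ gaussianReal 0 1 := by
    rw [Ym, marg_law]; exact withDensity_absolutelyContinuous _ _
  have h : (Ym P s).rnDeriv (gaussianReal 0 1) =ᵐ[gaussianReal 0 1]
      fun y => ENNReal.ofReal (Mk P s y) := by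
    rw [Ym, marg_law]
    exact Measure.rnDeriv_withDensity _ (by fun_prop)
  refine ⟨hac, ?_⟩
  filter_upwards [hac.ae_le h] with p hp
  rw [llr, hp, ENNReal.toReal_ofReal (Mk_pos _ _ _).le]

lemma kl_upper (P : Measure ℝ) [IsProbabilityMeasure P] (h1 : Integrable (fun w => w) P)
    (h2 : Integrable (fun w => w ^ 2) P) (h0 : ∫ w, w ∂P = 0) (s : ℝ) :
    InformationTheory.klDiv (Jm P s) (P.prod (Ym P s)) ≤
      ENNReal.ofReal (s ^ 2 * (∫ w, w ^ 2 ∂P) / 2) := by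
  have g1 : Integrable (fun u : ℝ => u) (gaussianReal 0 1) :=
    (memLp_id_gaussianReal (μ := 0) (v := 1) 1).integrable (by simp)
  have g2 : Integrable (fun u : ℝ => u ^ 2) (gaussianReal 0 1) :=
    (memLp_id_gaussianReal (μ := 0) (v := 1) 2).integrable_sq
  have hzz : Integrable (fun p : ℝ × ℝ => p.1 ^ 2) (P.prod (gaussianReal 0 1)) := h2.comp_fst _
  have huu : Integrable (fun p : ℝ × ℝ => p.2 ^ 2) (P.prod (gaussianReal 0 1)) := g2.comp_snd _
  have hzu : Integrable (fun p : ℝ × ℝ => p.1 * p.2) (P.prod (gaussianReal 0 1)) := h1.mul_prod g1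
  have hLi : Integrable (fun p : ℝ × ℝ => s * p.1 * p.2 - s ^ 2 * p.1 ^ 2 / 2) (Jm P s) := by
    rw [Jm, integrable_map_measure (by fun_prop) (by fun_prop)]
    refine ((hzz.const_mul (s ^ 2 / 2)).add (hzu.const_mul s)).congr (ae_of_all _ fun p => ?_)
    simp; ring
  have hLe : ∫ p, (s * p.1 * p.2 - s ^ 2 * p.1 ^ 2 / 2) ∂(Jm P s) = s ^ 2 * (∫ w, w ^ 2 ∂P) / 2 := by
    rw [Jm, integral_map (by fun_prop) (by fun_prop)]
    calc _ = ∫ p : ℝ × ℝ, (s ^ 2 / 2 * p.1 ^ 2 + s * (p.1 * p.2)) ∂(P.prod (gaussianReal 0 1)) := by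
            congr 1; ext p; ring
      _ = _ := by
        rw [integral_add (hzz.const_mul (s ^ 2 / 2)) (hzu.const_mul s), integral_const_mul,
          integral_const_mul, integral_prod_mul (fun z : ℝ => z) (fun u : ℝ => u), h0,
          integral_fun_fst (fun z : ℝ => z ^ 2)]
        simp; ring
  have hMY : Integrable (fun y => Real.log (Mk P s y)) (Ym P s) := by
    have hb : Integrable (fun y : ℝ => y ^ 2 / 2 + s ^ 2 * (∫ w, w ^ 2 ∂P) / 2) (Ym P s) := by
      refine Integrable.add ?_ (integrable_const _)
      rw [Ym, integrable_map_measure (by fun_prop) (by fun_prop)]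
      refine (((hzz.const_mul (s ^ 2 / 2)).add (hzu.const_mul s)).add (huu.const_mul (1 / 2))).congr
        (ae_of_all _ fun p => ?_)
      simp; ring
    have hV : 0 ≤ ∫ w, w ^ 2 ∂P := integral_nonneg fun w => sq_nonneg w
    refine hb.mono' (Real.measurable_log.comp (measurable_Mk P s)).aestronglyMeasurable (ae_of_all _ fun y => ?_)
    have a1 := Real.log_le_log (Mk_pos P s y) (Mk_le P s y)
    have a2 := Real.log_le_log (Real.exp_pos _) (Mk_ge P h1 h2 h0 s y)
    rw [Real.log_exp] at a1 a2
    rw [Real.norm_eq_abs, abs_le]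
    constructor
    · linarith [sq_nonneg y]
    · nlinarith [mul_nonneg (sq_nonneg s) hV]
  have hsnd : (Jm P s).map Prod.snd = Ym P s := by
    rw [Jm, Measure.map_map (by fun_prop) (by fun_prop)]; rfl
  have hMJ : Integrable (fun p : ℝ × ℝ => Real.log (Mk P s p.2)) (Jm P s) := by
    rw [← hsnd] at hMY
    exact hMY.comp_measurable measurable_snd
  have hMe : ∫ p, Real.log (Mk P s p.2) ∂(Jm P s) = ∫ y, Real.log (Mk P s y) ∂(Ym P s) := by
    rw [← hsnd]
    exact (integral_map measurable_snd.aemeasurable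
      (Real.measurable_log.comp (measurable_Mk P s)).aestronglyMeasurable).symm
  have hMn : 0 ≤ ∫ y, Real.log (Mk P s y) ∂(Ym P s) := by
    obtain ⟨hac, hl⟩ := Y_llr P s
    have := InformationTheory.integral_llr_add_sub_measure_univ_nonneg hac (hMY.congr hl.symm)
    rw [integral_congr_ae hl] at this
    simpa using this
  have hint := (hLi.sub hMJ).congr (J_llr P s).symm
  rw [InformationTheory.klDiv_of_ac_of_integrable (J_ac P s) hint, integral_congr_ae (J_llr P s),
    integral_sub hLi hMJ, hLe, hMe]
  apply ENNReal.ofReal_le_ofReal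
  simp
  linarith

lemma kl_eq (P : Measure ℝ) [IsProbabilityMeasure P] (s : ℝ) :
    InformationTheory.klDiv (Jm P s) (P.prod (Ym P s)) =
      ∫⁻ p, ENNReal.ofReal (Mk P s p.2 * InformationTheory.klFun (Lk s p.1 p.2 / Mk P s p.2))
        ∂(P.prod (gaussianReal 0 1)) := by
  have hm := InformationTheory.measurable_klFun
  rw [InformationTheory.klDiv_eq_lintegral_klFun_of_ac (J_ac P s)]
  calc _ = ∫⁻ p, ENNReal.ofReal (InformationTheory.klFun (Lk s p.1 p.2 / Mk P s p.2))
        ∂(P.prod (Ym P s)) := by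
        refine lintegral_congr_ae ?_
        filter_upwards [J_rn P s] with p hp
        rw [hp, ENNReal.toReal_ofReal (div_pos (Lk_pos _ _ _) (Mk_pos _ _ _)).le]
    _ = _ := by
        rw [Q_eq, lintegral_withDensity_eq_lintegral_mul _ (by fun_prop) (by fun_prop)]
        refine lintegral_congr fun p => ?_
        simp only [Pi.mul_apply]
        rw [← ENNReal.ofReal_mul (Mk_pos _ _ _).le]

lemma klFun_ge (h : ℝ) (hh : |h| ≤ 1 / 2) :
    h ^ 2 * (1 / 2 - 4 * |h|) ≤ InformationTheory.klFun (1 + h) := by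
  have := Real.abs_log_sub_add_sum_range_le (x := -h) (by rw [abs_neg]; linarith) 2
  simp only [Finset.sum_range_succ, Finset.sum_range_zero, abs_neg, sub_neg_eq_add] at this
  have hb : |h| ^ (2 + 1) / (1 - |h|) ≤ 2 * |h| ^ 3 := by
    rw [div_le_iff₀ (by linarith)]
    have := mul_nonneg (pow_nonneg (abs_nonneg h) 3) (sub_nonneg.mpr hh)
    have e : |h| ^ (2 + 1) = |h| ^ 3 := rfl
    rw [e]
    linarith
  have := (abs_le.mp (this.trans hb)).1
  norm_num at this
  have hl : h - h ^ 2 / 2 - 2 * |h| ^ 3 ≤ Real.log (1 + h) := by linarith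
  have hp : 0 < 1 + h := by linarith [(abs_le.mp hh).1]
  have h3 : h ^ 3 ≤ |h| ^ 3 := by rw [← abs_pow]; exact le_abs_self _
  have h2 : h ^ 2 * |h| = |h| ^ 3 := by rw [← sq_abs]; ring
  have h4 : (1 + h) * |h| ^ 3 ≤ 3 / 2 * |h| ^ 3 := by
    gcongr; linarith [(abs_le.mp hh).2]
  have := mul_le_mul_of_nonneg_left hl hp.le
  rw [InformationTheory.klFun_apply]
  nlinarith [pow_nonneg (abs_nonneg h) 3]

lemma pointwise_liminf (P : Measure ℝ) [IsProbabilityMeasure P] (h1 : Integrable (fun w => w) P)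
    (h0 : ∫ w, w ∂P = 0) (w y : ℝ) :
    ENNReal.ofReal ((w * y) ^ 2 / 2) ≤ liminf (fun s : ℝ => ENNReal.ofReal
      (Mk P s y * InformationTheory.klFun (Lk s w y / Mk P s y) / s ^ 2)) (𝓝[>] 0) := by
  have hM := hasDerivAt_Mk P h1 h0 y
  have hM0 : Mk P 0 y = 1 := by simp [Mk, Lk]
  have hL0 : Lk 0 w y = 1 := by simp [Lk]
  have hr : HasDerivAt (fun s => Lk s w y / Mk P s y) (w * y) 0 := by
    refine ((hasDerivAt_Lk 0 w y).div hM (Mk_pos P 0 y).ne').congr_deriv ?_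
    rw [hM0, hL0]; simp
  have hle : 𝓝[>] (0 : ℝ) ≤ 𝓝 0 := nhdsWithin_le_nhds
  have t1 : Tendsto (fun s => (Lk s w y / Mk P s y - 1) / s) (𝓝[>] 0) (𝓝 (w * y)) := by
    have := (hasDerivAt_iff_tendsto_slope.mp hr).mono_left
      (nhdsWithin_mono (0 : ℝ) (s := Set.Ioi 0) (fun x hx => ne_of_gt hx))
    refine this.congr fun s => ?_
    simp [slope_def_field, hM0, hL0]
  have t2 : Tendsto (fun s => Lk s w y / Mk P s y - 1) (𝓝[>] 0) (𝓝 0) := by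
    have := (hr.continuousAt.tendsto.mono_left hle).sub_const 1
    simpa [hM0, hL0] using this
  have t3 : Tendsto (fun s => Mk P s y) (𝓝[>] 0) (𝓝 1) := by
    have := hM.continuousAt.tendsto.mono_left hle
    simpa [hM0] using this
  have t4 : Tendsto (fun s => Mk P s y * (((Lk s w y / Mk P s y - 1) / s) ^ 2 *
      (1 / 2 - 4 * |Lk s w y / Mk P s y - 1|))) (𝓝[>] 0) (𝓝 ((w * y) ^ 2 / 2)) := by
    have := t3.mul ((t1.pow 2).mul (tendsto_const_nhds (x := (1 / 2 : ℝ)) |>.sub (t2.abs.const_mul 4)))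
    have e : 1 * ((w * y) ^ 2 * (1 / 2 - 4 * |(0 : ℝ)|)) = (w * y) ^ 2 / 2 := by
      rw [abs_zero]; ring
    rwa [e] at this
  have t5 := (ENNReal.continuous_ofReal.tendsto _).comp t4
  rw [← t5.liminf_eq]
  refine liminf_le_liminf ?_
  have e : ∀ᶠ s in 𝓝[>] (0 : ℝ), |Lk s w y / Mk P s y - 1| < 1 / 2 := by
    have := t2.abs
    rw [abs_zero] at this
    exact this.eventually_lt_const (by norm_num)
  filter_upwards [e] with s hs
  apply ENNReal.ofReal_le_ofReal
  have := klFun_ge _ hs.le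
  rw [add_sub_cancel] at this
  rw [mul_div_assoc]
  refine mul_le_mul_of_nonneg_left ?_ (Mk_pos P s y).le
  rw [div_pow, div_mul_eq_mul_div]
  gcongr

lemma core (P : Measure ℝ) [IsProbabilityMeasure P] (h1 : Integrable (fun w => w) P)
    (h2 : Integrable (fun w => w ^ 2) P) (h0 : ∫ w, w ∂P = 0) :
    Tendsto (fun s : ℝ => InformationTheory.klDiv (Jm P s) (P.prod (Ym P s)) / ENNReal.ofReal (s ^ 2))
      (𝓝[>] 0) (𝓝 (ENNReal.ofReal ((∫ w, w ^ 2 ∂P) / 2))) := by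
  have hm := InformationTheory.measurable_klFun
  refine tendsto_of_le_liminf_of_limsup_le ?_ ?_
  · have hfat := lintegral_liminf_le (μ := P.prod (gaussianReal 0 1)) (u := 𝓝[>] (0 : ℝ))
      (f := fun s p => ENNReal.ofReal
        (Mk P s p.2 * InformationTheory.klFun (Lk s p.1 p.2 / Mk P s p.2) / s ^ 2))
      (fun s => by fun_prop)
    have hI : ENNReal.ofReal ((∫ w, w ^ 2 ∂P) / 2) =
        ∫⁻ p, ENNReal.ofReal ((p.1 * p.2) ^ 2 / 2) ∂(P.prod (gaussianReal 0 1)) := by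
      have g2 : Integrable (fun u : ℝ => u ^ 2) (gaussianReal 0 1) :=
        (memLp_id_gaussianReal (μ := 0) (v := 1) 2).integrable_sq
      have gv : ∫ u, u ^ 2 ∂(gaussianReal 0 1) = 1 := by
        have := variance_fun_id_gaussianReal (μ := 0) (v := 1)
        rw [variance_of_integral_eq_zero (by fun_prop) (by simp)] at this
        simpa using this
      have hi : Integrable (fun p : ℝ × ℝ => (p.1 * p.2) ^ 2 / 2) (P.prod (gaussianReal 0 1)) := by
        refine ((h2.mul_prod g2).div_const 2).congr (ae_of_all _ fun p => ?_)
        simp [mul_pow]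
      rw [← ofReal_integral_eq_lintegral_ofReal hi (ae_of_all _ fun p => by positivity)]
      congr 1
      simp_rw [mul_pow]
      rw [integral_div, integral_prod_mul (fun z : ℝ => z ^ 2) (fun u : ℝ => u ^ 2), gv, mul_one]
    rw [hI]
    have hmono := lintegral_mono (μ := P.prod (gaussianReal 0 1))
      (fun p : ℝ × ℝ => pointwise_liminf P h1 h0 p.1 p.2)
    refine le_trans hmono (le_trans hfat ?_)
    refine liminf_le_liminf ?_
    filter_upwards [self_mem_nhdsWithin] with s hs
    have hs : 0 < s := hs
    rw [kl_eq]
    apply le_of_eq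
    have hmeas : Measurable (fun p : ℝ × ℝ => ENNReal.ofReal (Mk P s p.2 *
        InformationTheory.klFun (Lk s p.1 p.2 / Mk P s p.2))) := by fun_prop
    rw [div_eq_mul_inv, ← lintegral_mul_const _ hmeas]
    refine lintegral_congr fun p => ?_
    rw [ENNReal.ofReal_div_of_pos (by positivity), div_eq_mul_inv]
  · refine limsup_le_of_le (by isBoundedDefault) ?_
    filter_upwards [self_mem_nhdsWithin] with s hs
    have hs : 0 < s := hs
    refine ENNReal.div_le_of_le_mul ((kl_upper P h1 h2 h0 s).trans ?_)
    rw [← ENNReal.ofReal_mul' (by positivity)]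
    apply le_of_eq; congr 1; ring

lemma klDiv_eq' {α : Type*} [MeasurableSpace α] (μ ν : Measure α) [IsProbabilityMeasure μ]
    [IsProbabilityMeasure ν] : klDiv μ ν = InformationTheory.klDiv μ ν := by
  unfold klDiv
  split_ifs with h
  · rw [InformationTheory.klDiv_of_ac_of_integrable h.1 h.2]; simp
  · rw [eq_comm, InformationTheory.klDiv_eq_top_iff]; tauto

lemma klDiv_map_inv {α : Type*} [MeasurableSpace α] (μ ν : Measure α) [IsProbabilityMeasure μ]
    [IsProbabilityMeasure ν] {f g : α → α} (hf : Measurable f) (hg : Measurable g)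
    (hgf : g ∘ f = id) :
    InformationTheory.klDiv (μ.map f) (ν.map f) = InformationTheory.klDiv μ ν := by
  refine le_antisymm (InformationTheory.klDiv_map_le _ _ hf) ?_
  have := InformationTheory.klDiv_map_le (μ.map f) (ν.map f) hg
  rwa [Measure.map_map hg hf, Measure.map_map hg hf, hgf, Measure.map_id, Measure.map_id] at this

lemma mutualInfo_eq {Ω : Type*} [MeasurableSpace Ω] (μ : Measure Ω) [IsProbabilityMeasure μ]
    (Z U : Ω → ℝ) (hZ : Measurable Z) (hU : Measurable U)
    (hZU : IndepFun Z U μ) (hU_law : μ.map U = gaussianReal 0 1) (m s : ℝ) :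
    mutualInfo μ Z (fun ω => s * Z ω + U ω) =
      InformationTheory.klDiv (Jm (μ.map fun ω => Z ω - m) s)
        ((μ.map fun ω => Z ω - m).prod (Ym (μ.map fun ω => Z ω - m) s)) := by
  have hp1 : IsProbabilityMeasure (μ.map Z) := Measure.isProbabilityMeasure_map (by fun_prop)
  have hp2 : IsProbabilityMeasure (μ.map fun ω => s * Z ω + U ω) :=
    Measure.isProbabilityMeasure_map (by fun_prop)
  have hp3 : IsProbabilityMeasure (μ.map fun ω => (Z ω, s * Z ω + U ω)) :=
    Measure.isProbabilityMeasure_map (by fun_prop)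
  have hp4 : IsProbabilityMeasure (μ.map fun ω => Z ω - m) :=
    Measure.isProbabilityMeasure_map (by fun_prop)
  have hprod : μ.map (fun ω => (Z ω - m, U ω)) = (μ.map fun ω => Z ω - m).prod (gaussianReal 0 1) := by
    have hi : IndepFun (fun ω => Z ω - m) U μ :=
      hZU.comp (φ := fun z => z - m) (ψ := id) (by fun_prop) measurable_id
    rw [← hU_law]
    exact (indepFun_iff_map_prod_eq_prod_map_map (by fun_prop) (by fun_prop)).mp hi
  have hJ : Jm (μ.map fun ω => Z ω - m) s = (μ.map fun ω => (Z ω, s * Z ω + U ω)).map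
      (Prod.map (fun z => z - m) (fun y => y - s * m)) := by
    rw [Jm, ← hprod, Measure.map_map (by fun_prop) (by fun_prop),
      Measure.map_map (by fun_prop) (by fun_prop)]
    congr 1; ext ω <;> simp; ring
  have hY : Ym (μ.map fun ω => Z ω - m) s = (μ.map fun ω => s * Z ω + U ω).map
      (fun y => y - s * m) := by
    rw [Ym, ← hprod, Measure.map_map (by fun_prop) (by fun_prop),
      Measure.map_map (by fun_prop) (by fun_prop)]
    congr 1; ext ω; simp; ring
  have hZm : (μ.map fun ω => Z ω - m) = (μ.map Z).map (fun z => z - m) := by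
    rw [Measure.map_map (by fun_prop) (by fun_prop)]; rfl
  have hQ : (μ.map fun ω => Z ω - m).prod (Ym (μ.map fun ω => Z ω - m) s) =
      ((μ.map Z).prod (μ.map fun ω => s * Z ω + U ω)).map
      (Prod.map (fun z => z - m) (fun y => y - s * m)) := by
    rw [hY, hZm, Measure.map_prod_map _ _ (by fun_prop) (by fun_prop)]
  rw [mutualInfo, klDiv_eq', hJ, hQ]
  refine (klDiv_map_inv _ _ (g := Prod.map (fun z => z + m) (fun y => y + s * m))
    (by fun_prop) (by fun_prop) ?_).symm
  ext p <;> simp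

/-- **Low-SNR expansion** (Lemma 1): as `δ → 0⁺`, the mutual information of the canonical
Gaussian channel `Y = √δ · Z + U` satisfies `I(Z; Y)/δ → Var(Z)/2`. -/
theorem tendsto_mutualInfo_div_snr_var
    {Ω : Type*} [MeasurableSpace Ω] (μ : Measure Ω) [IsProbabilityMeasure μ]
    (Z U : Ω → ℝ) (hZ : Measurable Z) (hU : Measurable U)
    (hZU : IndepFun Z U μ)
    (hU_law : μ.map U = gaussianReal 0 1)
    (hZ2 : Integrable (fun ω => Z ω ^ 2) μ) :
    Tendsto (fun δ : ℝ =>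
        (mutualInfo μ Z (fun ω => Real.sqrt δ * Z ω + U ω)).toReal / δ)
      (𝓝[>] 0) (𝓝 (variance Z μ / 2)) := by
  set m := ∫ ω, Z ω ∂μ with hm
  have hZL : MemLp Z 2 μ := (memLp_two_iff_integrable_sq (by fun_prop)).mpr hZ2
  have hWL : MemLp (fun ω => Z ω - m) 2 μ := hZL.sub (memLp_const m)
  have hZi : Integrable Z μ := hZL.integrable (by norm_num)
  set P := μ.map fun ω => Z ω - m with hP
  have hp : IsProbabilityMeasure P := Measure.isProbabilityMeasure_map (by fun_prop)
  have h1 : Integrable (fun w : ℝ => w) P := by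
    rw [hP, integrable_map_measure (by fun_prop) (by fun_prop)]
    exact hWL.integrable (by norm_num)
  have h2 : Integrable (fun w : ℝ => w ^ 2) P := by
    rw [hP, integrable_map_measure (by fun_prop) (by fun_prop)]
    exact hWL.integrable_sq
  have h0 : ∫ w, w ∂P = 0 := by
    rw [hP, integral_map (by fun_prop) (by fun_prop), integral_sub hZi (integrable_const _)]
    simp [hm]
  have hV : ∫ w, w ^ 2 ∂P = variance Z μ := by
    rw [hP, integral_map (by fun_prop) (by fun_prop), variance_eq_integral (by fun_prop)]
  have hc := core P h1 h2 h0
  rw [hV] at hc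
  have hs : Tendsto (fun δ : ℝ => Real.sqrt δ) (𝓝[>] 0) (𝓝[>] 0) := by
    refine tendsto_nhdsWithin_iff.mpr ⟨?_, ?_⟩
    · have := (Real.continuous_sqrt.tendsto 0).mono_left (nhdsWithin_le_nhds (s := Set.Ioi (0 : ℝ)))
      simpa using this
    · filter_upwards [self_mem_nhdsWithin] with δ hδ using Real.sqrt_pos.mpr hδ
  have hf := (ENNReal.tendsto_toReal ENNReal.ofReal_ne_top).comp (hc.comp hs)
  rw [ENNReal.toReal_ofReal (by have := variance_nonneg Z μ; positivity)] at hf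
  refine hf.congr' ?_
  filter_upwards [self_mem_nhdsWithin] with δ hδ
  have hδ : 0 < δ := hδ
  simp only [Function.comp]
  rw [mutualInfo_eq μ Z U hZ hU hZU hU_law m, ENNReal.toReal_div, Real.sq_sqrt hδ.le,
    ENNReal.toReal_ofReal hδ.le]
end
end
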